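/- Let 0 → Y →ι X →π Z → 0 be an exact sequence of Banach spaces and bounded operators (ι is an isomorphic embedding with range equal to ker π, and π is surjective), and let t : Y → B be a bounded operator. Form the push-out PO = PO(ι, t) with canonical maps t′ : X → PO and ι′ : B → PO. Then: (i) ι′ is an isomorphic embedding (bounded below); (ii) there is a unique bounded operator ϖ : PO → Z with ϖ ∘ t′ = π and ϖ ∘ ι′ = 0, given by ϖ((x,b) + S̄) = π(x); and (iii) the sequence 0 → B →ι′ PO →ϖ Z → 0 is exact. -/

import Mathlib

/-!
The push-out sequence associated to an exact sequence `0 → Y → X → Z → 0` of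
Banach spaces and a bounded operator `t : Y → B`:
(i) `ι' : B → PO` is an isomorphic embedding;
(ii) there is a unique bounded operator `ϖ : PO → Z` with `ϖ ∘ t' = π`,
`ϖ ∘ ι' = 0`, given by `ϖ((x,b) + S̄) = π x`;
(iii) `0 → B → PO → Z → 0` is exact.
-/

noncomputable section

open scoped ENNReal

variable {Y A B C : Type*}
  [NormedAddCommGroup Y] [NormedSpace ℂ Y]
  [NormedAddCommGroup A] [NormedSpace ℂ A]
  [NormedAddCommGroup B] [NormedSpace ℂ B]

/-- The (closure of the) subspace `{(α y, -β y) : y ∈ Y}` of `A ⊕₁ B`. -/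
def poSub (α : Y →L[ℂ] A) (β : Y →L[ℂ] B) : Submodule ℂ (WithLp 1 (A × B)) :=
  (LinearMap.range
    ((WithLp.linearEquiv 1 ℂ (A × B)).symm.toLinearMap.comp
      ((α : Y →ₗ[ℂ] A).prod (-(β : Y →ₗ[ℂ] B))))).topologicalClosure

/-- The push-out space `PO(α, β) = (A ⊕₁ B) / S̄`. -/
def PO (α : Y →L[ℂ] A) (β : Y →L[ℂ] B) : Type _ :=
  WithLp 1 (A × B) ⧸ poSub α β

instance poSub_isClosed (α : Y →L[ℂ] A) (β : Y →L[ℂ] B) :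
    IsClosed ((poSub α β : Submodule ℂ (WithLp 1 (A × B))) : Set (WithLp 1 (A × B))) :=
  Submodule.isClosed_topologicalClosure _

instance (α : Y →L[ℂ] A) (β : Y →L[ℂ] B) : NormedAddCommGroup (PO α β) :=
  inferInstanceAs (NormedAddCommGroup (WithLp 1 (A × B) ⧸ poSub α β))

instance (α : Y →L[ℂ] A) (β : Y →L[ℂ] B) : NormedSpace ℂ (PO α β) :=
  inferInstanceAs (NormedSpace ℂ (WithLp 1 (A × B) ⧸ poSub α β))

/-- The class of `(a, b)` in the push-out. -/
def poMk (α : Y →L[ℂ] A) (β : Y →L[ℂ] B) (x : A × B) : PO α β :=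
  (Submodule.Quotient.mk ((WithLp.equiv 1 (A × B)).symm x) : WithLp 1 (A × B) ⧸ poSub α β)

/-- The canonical map `A → PO(α, β)`, `a ↦ (a, 0) + S̄`. -/
def poInl (α : Y →L[ℂ] A) (β : Y →L[ℂ] B) (a : A) : PO α β := poMk α β (a, 0)

/-- The canonical map `B → PO(α, β)`, `b ↦ (0, b) + S̄`. -/
def poInr (α : Y →L[ℂ] A) (β : Y →L[ℂ] B) (b : B) : PO α β := poMk α β (0, b)

/-- The generators of `poSub α β` lie in it. -/
theorem mem_poSub (α : Y →L[ℂ] A) (β : Y →L[ℂ] B) (y : Y) :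
    WithLp.toLp 1 (α y, -β y) ∈ poSub α β :=
  Submodule.le_topologicalClosure _ ⟨y, rfl⟩

/-- A closed set containing all the generators `(α y, -β y)` contains `poSub α β`. -/
theorem poSub_subset {α : Y →L[ℂ] A} {β : Y →L[ℂ] B} {K : Set (WithLp 1 (A × B))}
    (hK : IsClosed K) (h : ∀ y, WithLp.toLp 1 (α y, -β y) ∈ K) :
    (poSub α β : Set (WithLp 1 (A × B))) ⊆ K := by
  refine closure_minimal ?_ hK
  rintro _ ⟨y, rfl⟩
  exact h y

theorem poMk_surjective (α : Y →L[ℂ] A) (β : Y →L[ℂ] B) : Function.Surjective (poMk α β) :=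
  (Submodule.Quotient.mk_surjective (poSub α β)).comp (WithLp.equiv 1 (A × B)).symm.surjective

theorem poMk_add (α : Y →L[ℂ] A) (β : Y →L[ℂ] B) (p q : A × B) :
    poMk α β (p + q) = poMk α β p + poMk α β q := rfl

/-- The push-out square commutes: `(α y, b)` and `(0, b + β y)` have the same class. -/
theorem poMk_map_left (α : Y →L[ℂ] A) (β : Y →L[ℂ] B) (y : Y) (b : B) :
    poMk α β (α y, b) = poInr α β (b + β y) := by
  refine (Submodule.Quotient.eq (poSub α β)).2 ?_
  have h : (WithLp.equiv 1 (A × B)).symm (α y, b) - (WithLp.equiv 1 (A × B)).symm (0, b + β y) =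
      WithLp.toLp 1 (α y, -β y) := by
    apply (WithLp.equiv 1 (A × B)).injective
    ext <;> simp
  rw [h]
  exact mem_poSub α β y

/-- If `k ≤ 1` and `k ‖β y‖ ≤ ‖α y‖` for all `y`, then `B → PO(α, β)` is bounded below by `k`. -/
theorem le_norm_poInr {α : Y →L[ℂ] A} {β : Y →L[ℂ] B} {k : ℝ} (hk₀ : 0 ≤ k) (hk₁ : k ≤ 1)
    (h : ∀ y, k * ‖β y‖ ≤ ‖α y‖) (b : B) : k * ‖b‖ ≤ ‖poInr α β b‖ := by
  have hK : IsClosed {m : WithLp 1 (A × B) | k * ‖b‖ ≤ ‖WithLp.toLp 1 ((0 : A), b) + m‖} :=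
    isClosed_le continuous_const (by fun_prop)
  have hsub := poSub_subset (α := α) (β := β) hK fun y ↦ by
    have hb : ‖b‖ ≤ ‖b - β y‖ + ‖β y‖ := by simpa using norm_add_le (b - β y) (β y)
    have hle : k * ‖b - β y‖ ≤ ‖b - β y‖ := mul_le_of_le_one_left (norm_nonneg _) hk₁
    have hmul := mul_le_mul_of_nonneg_left hb hk₀
    have hy := h y
    simp only [Set.mem_ofPred_eq, ← WithLp.toLp_add, WithLp.prod_norm_eq_of_L1, Prod.mk_add_mk,
      zero_add, WithLp.toLp_fst, WithLp.toLp_snd, ← sub_eq_add_neg]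
    linarith
  refine QuotientAddGroup.le_norm_iff.2 fun m hm ↦ ?_
  have hmem := hsub ((Submodule.Quotient.eq (poSub α β)).1 hm)
  simpa using hmem

/-- The operator `PO(α, β) → C`, `(a, b) + S̄ ↦ φ a`, for `φ` vanishing on the range of `α`. -/
def poDesc [NormedAddCommGroup C] [NormedSpace ℂ C]
    (α : Y →L[ℂ] A) (β : Y →L[ℂ] B) (φ : A →L[ℂ] C) (h : ∀ y, φ (α y) = 0) : PO α β →L[ℂ] C :=
  (poSub α β).liftQL (φ.comp (WithLp.fstL 1 ℂ A B))
    (poSub_subset (φ.comp (WithLp.fstL 1 ℂ A B)).isClosed_ker h)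

theorem poDesc_poMk [NormedAddCommGroup C] [NormedSpace ℂ C]
    {α : Y →L[ℂ] A} {β : Y →L[ℂ] B} {φ : A →L[ℂ] C} (h : ∀ y, φ (α y) = 0) (a : A) (b : B) :
    poDesc α β φ h (poMk α β (a, b)) = φ a := rfl

/-- **The push-out sequence.**  Given an exact sequence
`0 → Y →ι X →π Z → 0` of Banach spaces and a bounded operator `t : Y → B`,
in the push-out `PO = PO(ι, t)` (with canonical maps `t' = poInl ι t : X → PO`
and `ι' = poInr ι t : B → PO`): `ι'` is an isomorphic embedding, there is a
unique bounded operator `ϖ : PO → Z` with `ϖ ∘ t' = π` and `ϖ ∘ ι' = 0`, given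
by `ϖ((x,b) + S̄) = π x`, and `0 → B →ι' PO →ϖ Z → 0` is exact. -/
theorem pushout_sequence
    {X Z : Type*} [NormedAddCommGroup X] [NormedSpace ℂ X]
    [NormedAddCommGroup Z] [NormedSpace ℂ Z]
    [CompleteSpace Y] [CompleteSpace X] [CompleteSpace B] [CompleteSpace Z]
    (ι : Y →L[ℂ] X) (π : X →L[ℂ] Z) (t : Y →L[ℂ] B)
    (hemb : ∃ c : ℝ, 0 < c ∧ ∀ y : Y, c * ‖y‖ ≤ ‖ι y‖)
    (hker : ∀ x : X, (∃ y : Y, ι y = x) ↔ π x = 0)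
    (hsurj : Function.Surjective π) :
    (∃ c : ℝ, 0 < c ∧ ∀ b : B, c * ‖b‖ ≤ ‖poInr ι t b‖) ∧
    ∃ ϖ : PO ι t →L[ℂ] Z,
      (∀ (x : X) (b : B), ϖ (poMk ι t (x, b)) = π x) ∧
      (∀ ϖ' : PO ι t →L[ℂ] Z,
        (∀ x : X, ϖ' (poInl ι t x) = π x) → (∀ b : B, ϖ' (poInr ι t b) = 0) →
          ϖ' = ϖ) ∧
      Function.Surjective ϖ ∧
      (∀ u : PO ι t, ϖ u = 0 ↔ ∃ b : B, poInr ι t b = u) := by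
  obtain ⟨c, hc, hι⟩ := hemb
  have hπι : ∀ y, π (ι y) = 0 := fun y ↦ (hker _).1 ⟨y, rfl⟩
  refine ⟨⟨c / (c + ‖t‖), by positivity, le_norm_poInr (by positivity) ?_ fun y ↦ ?_⟩,
    poDesc ι t π hπι, poDesc_poMk hπι, fun ϖ' hl hr ↦ ?_, fun z ↦ ?_, fun u ↦ ⟨fun hu ↦ ?_, ?_⟩⟩
  · exact div_le_one_of_le₀ (by linarith [norm_nonneg t]) (by positivity)
  · rw [div_mul_eq_mul_div, div_le_iff₀ (by positivity)]
    calc c * ‖t y‖ ≤ c * (‖t‖ * ‖y‖) := by gcongr; exact t.le_opNorm y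
      _ = (c * ‖y‖) * ‖t‖ := by ring
      _ ≤ ‖ι y‖ * (c + ‖t‖) := by
        gcongr
        · exact hι y
        · linarith
  · ext u
    obtain ⟨⟨x, b⟩, rfl⟩ := poMk_surjective ι t u
    have hsplit : poMk ι t (x, b) = poInl ι t x + poInr ι t b := by
      simp [poInl, poInr, ← poMk_add]
    rw [poDesc_poMk, hsplit, map_add, hl, hr, add_zero]
  · obtain ⟨x, rfl⟩ := hsurj z
    exact ⟨poMk ι t (x, 0), poDesc_poMk hπι x 0⟩
  · obtain ⟨⟨x, b⟩, rfl⟩ := poMk_surjective ι t u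
    obtain ⟨y, rfl⟩ := (hker x).2 hu
    exact ⟨b + t y, (poMk_map_left ι t y b).symm⟩
  · rintro ⟨b, rfl⟩
    exact (poDesc_poMk hπι 0 b).trans (map_zero π)
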